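/- The EKF2 update is invariant under an invertible linear transformation of the measurement model: let D ∈ ℝ^{d×d} be invertible and suppose S = J P Jᵀ + (1/2) Ξ + R is invertible. Define the transformed model by Ĵ = D J, Ĥ_i = Σ_{k=1}^d D_{i,k} H_k, R̂ = D R Dᵀ, ŷ = D y, ẑ = D z, and let ξ̂, Ξ̂, Ŝ, K̂, μ̂⁺, P̂⁺ be the EKF2 update quantities computed from the transformed model. Then μ̂⁺ = μ⁺ and P̂⁺ = P⁺. -/

import Mathlib

open Matrix

/-- The EKF2 update is invariant under an invertible linear transformation of the measurement
model: the transformed posterior mean and covariance equal the untransformed ones. -/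
theorem ekf2_update_invariant_under_linear_transform {n d : ℕ}
    (μ : Fin n → ℝ)
    (P : Matrix (Fin n) (Fin n) ℝ)
    (J : Matrix (Fin d) (Fin n) ℝ)
    (H : Fin d → Matrix (Fin n) (Fin n) ℝ)
    (R : Matrix (Fin d) (Fin d) ℝ)
    (z y : Fin d → ℝ)
    (D : Matrix (Fin d) (Fin d) ℝ) (hD : IsUnit D.det)
    -- EKF2 update quantities for the original measurement model
    (ξ : Fin d → ℝ) (hξ : ∀ i, ξ i = (P * H i).trace)
    (Ξ : Matrix (Fin d) (Fin d) ℝ)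
    (hΞ : ∀ i j, Ξ i j = (P * H i * P * H j).trace)
    (S : Matrix (Fin d) (Fin d) ℝ)
    (hS : S = J * P * Jᵀ + (1 / 2 : ℝ) • Ξ + R) (hSinv : IsUnit S.det)
    (K : Matrix (Fin n) (Fin d) ℝ) (hK : K = P * Jᵀ * S⁻¹)
    (μplus : Fin n → ℝ) (hμplus : μplus = μ + K.mulVec (y - z - (1 / 2 : ℝ) • ξ))
    (Pplus : Matrix (Fin n) (Fin n) ℝ) (hPplus : Pplus = P - K * S * Kᵀ)
    -- the transformed measurement model
    (Jhat : Matrix (Fin d) (Fin n) ℝ) (hJhat : Jhat = D * J)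
    (Hhat : Fin d → Matrix (Fin n) (Fin n) ℝ)
    (hHhat : ∀ i, Hhat i = ∑ k, D i k • H k)
    (Rhat : Matrix (Fin d) (Fin d) ℝ) (hRhat : Rhat = D * R * Dᵀ)
    (yhat : Fin d → ℝ) (hyhat : yhat = D.mulVec y)
    (zhat : Fin d → ℝ) (hzhat : zhat = D.mulVec z)
    -- EKF2 update quantities for the transformed measurement model
    (ξhat : Fin d → ℝ) (hξhat : ∀ i, ξhat i = (P * Hhat i).trace)
    (Ξhat : Matrix (Fin d) (Fin d) ℝ)
    (hΞhat : ∀ i j, Ξhat i j = (P * Hhat i * P * Hhat j).trace)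
    (Shat : Matrix (Fin d) (Fin d) ℝ)
    (hShat : Shat = Jhat * P * Jhatᵀ + (1 / 2 : ℝ) • Ξhat + Rhat)
    (Khat : Matrix (Fin n) (Fin d) ℝ) (hKhat : Khat = P * Jhatᵀ * Shat⁻¹)
    (μhatplus : Fin n → ℝ)
    (hμhatplus : μhatplus = μ + Khat.mulVec (yhat - zhat - (1 / 2 : ℝ) • ξhat))
    (Phatplus : Matrix (Fin n) (Fin n) ℝ)
    (hPhatplus : Phatplus = P - Khat * Shat * Khatᵀ) :
    μhatplus = μplus ∧ Phatplus = Pplus := by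
  have h_xi : ξhat = D *ᵥ ξ := by
    ext i
    simp [hξhat, hHhat, hξ, mulVec, dotProduct, Finset.mul_sum, trace_sum]
  have h_Xi : Ξhat = D * Ξ * Dᵀ := by
    ext i j
    simp only [hΞhat, hHhat, Matrix.mul_apply (M := D) (N := Ξ), Matrix.mul_apply (M := D * Ξ), hΞ, transpose_apply,
      Finset.mul_sum, Finset.sum_mul, trace_sum, mul_smul_comm, smul_mul_assoc, trace_smul,
      smul_eq_mul]
    exact Finset.sum_congr rfl fun _ _ => Finset.sum_congr rfl fun _ _ => by ring
  have h_S : Shat = D * S * Dᵀ := by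
    rw [hShat, hS, hJhat, h_Xi, hRhat]
    simp only [transpose_mul, Matrix.mul_add, Matrix.add_mul, Matrix.mul_smul, Matrix.smul_mul,
      Matrix.mul_assoc]
  have h_K : Khat * D = K := by
    have hDt : IsUnit Dᵀ.det := by rwa [det_transpose]
    rw [hKhat, h_S, hJhat, hK, transpose_mul, Matrix.mul_inv_rev, Matrix.mul_inv_rev]
    simp only [Matrix.mul_assoc]
    rw [nonsing_inv_mul D hD, Matrix.mul_one, mul_nonsing_inv_cancel_left _ _ hDt]
  constructor
  · have h_innovation :
        yhat - zhat - (1 / 2 : ℝ) • ξhat = D *ᵥ (y - z - (1 / 2 : ℝ) • ξ) := by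
      rw [hyhat, hzhat, h_xi, mulVec_sub, mulVec_sub, mulVec_smul]
    rw [hμhatplus, hμplus, h_innovation, mulVec_mulVec, h_K]
  · rw [hPhatplus, hPplus, h_S, ← h_K, transpose_mul]
    simp only [Matrix.mul_assoc]
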